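/- Let ψ : ℂ[T₁,T₂,T₃,T₄,T₅] → ℂ[z₁,z₂,z₃,z₄,z₅,z₆] be the ℂ-algebra homomorphism with ψ(T₁) = z₁z₃, ψ(T₂) = z₂z₅, ψ(T₃) = z₄z₆, ψ(T₄) = z₁z₄z₅, ψ(T₅) = z₂z₃z₆. Then a polynomial f ∈ ℂ[z₁,…,z₆] lies in the image of ψ if and only if every monomial z₁^{n₁}⋯z₆^{n₆} occurring in f satisfies the two equations −n₁ − 2n₂ + n₃ − n₄ + 2n₅ + n₆ = 0 and n₁ − n₂ − n₃ − 2n₄ + n₅ + 2n₆ = 0. -/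

import Mathlib

open MvPolynomial

/-- `ψ(T₁)=z₁z₃, ψ(T₂)=z₂z₅, ψ(T₃)=z₄z₆, ψ(T₄)=z₁z₄z₅, ψ(T₅)=z₂z₃z₆`
(variables indexed by `Fin 5` and `Fin 6`, zero-based). -/
noncomputable def psiC : MvPolynomial (Fin 5) ℂ →ₐ[ℂ] MvPolynomial (Fin 6) ℂ :=
  aeval ![X 0 * X 2, X 1 * X 4, X 3 * X 5, X 0 * X 3 * X 4, X 1 * X 2 * X 5]

/-- The weights of the variables under the two-dimensional torus. -/
def torusWeight : Fin 6 → ℤ × ℤ :=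
  ![(-1, 1), (-2, -1), (1, -1), (-1, -2), (2, 1), (1, 2)]

lemma weight_torusWeight_eq_zero_iff (d : Fin 6 →₀ ℕ) :
    Finsupp.weight torusWeight d = 0 ↔
      (-(d 0 : ℤ) - 2 * d 1 + d 2 - d 3 + 2 * d 4 + d 5 = 0 ∧
       (d 0 : ℤ) - d 1 - d 2 - 2 * d 3 + d 4 + 2 * d 5 = 0) := by
  rw [Finsupp.weight_apply, Finsupp.sum_fintype _ _ (by simp)]
  simp only [Fin.sum_univ_six, torusWeight, Prod.ext_iff]
  simp
  grind

lemma isWeightedHomogeneous_psiC (p : MvPolynomial (Fin 5) ℂ) :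
    IsWeightedHomogeneous torusWeight (psiC p) 0 := by
  induction p using MvPolynomial.induction_on with
  | C a =>
    rw [algHom_C]
    exact isWeightedHomogeneous_C _ a
  | add p q hp hq =>
    rw [map_add]
    exact hp.add hq
  | mul_X p i hp =>
    rw [map_mul, ← add_zero (0 : ℤ × ℤ)]
    refine hp.mul ?_
    have hX (j : Fin 6) := isWeightedHomogeneous_X ℂ torusWeight j
    rw [psiC, aeval_X]
    fin_cases i
    · exact (hX 0).mul (hX 2)
    · exact (hX 1).mul (hX 4)
    · exact (hX 3).mul (hX 5)
    · exact ((hX 0).mul (hX 3)).mul (hX 4)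
    · exact ((hX 1).mul (hX 2)).mul (hX 5)

lemma monomial_mem_range_psiC {d : Fin 6 →₀ ℕ} (a : ℂ)
    (hd : Finsupp.weight torusWeight d = 0) : monomial d a ∈ psiC.range := by
  obtain ⟨h₁, h₂⟩ := (weight_torusWeight_eq_zero_iff d).1 hd
  rw [monomial_eq, Finsupp.prod_fintype _ _ (by simp), Fin.prod_univ_six]
  rcases le_total (d 2) (d 0) with h | h
  · obtain ⟨k, h0⟩ := Nat.exists_eq_add_of_le h
    have h4 : d 4 = d 1 + k := by lia
    have h3 : d 3 = d 5 + k := by lia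
    refine ⟨C a * (X 0 ^ d 2 * X 1 ^ d 1 * X 2 ^ d 5 * X 3 ^ k), ?_⟩
    simp [psiC, h0, h4, h3, algebraMap_eq, -mul_eq_mul_left_iff]
    ring
  · obtain ⟨k, h2⟩ := Nat.exists_eq_add_of_le h
    have h1 : d 1 = d 4 + k := by lia
    have h5 : d 5 = d 3 + k := by lia
    refine ⟨C a * (X 0 ^ d 0 * X 1 ^ d 4 * X 2 ^ d 3 * X 4 ^ k), ?_⟩
    simp [psiC, h2, h1, h5, algebraMap_eq, -mul_eq_mul_left_iff]
    ring

theorem stmt_9 (f : MvPolynomial (Fin 6) ℂ) :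
    f ∈ psiC.range ↔
      ∀ d : Fin 6 →₀ ℕ, coeff d f ≠ 0 →
        (-(d 0 : ℤ) - 2 * d 1 + d 2 - d 3 + 2 * d 4 + d 5 = 0 ∧
         (d 0 : ℤ) - d 1 - d 2 - 2 * d 3 + d 4 + 2 * d 5 = 0) := by
  simp only [← weight_torusWeight_eq_zero_iff]
  constructor
  · rintro ⟨p, rfl⟩ d hd
    exact isWeightedHomogeneous_psiC p hd
  · intro hf
    rw [f.as_sum]
    exact sum_mem fun d hd => monomial_mem_range_psiC _ (hf d (mem_support_iff.1 hd))
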